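/- arXiv:1801.07808 — 2 statements merged into one kernel-verified Lean document; each statement's English description precedes it below -/
import Mathlib

section
/- Let G and H be finite connected simple graphs. Then π(G □ H) ≤ 2·π(G)·π(H). -/
/-- A single pebbling move on `G`: remove two pebbles from a vertex `u`
and place one pebble on an adjacent vertex `v`. -/
def PebblingStep {V : Type*} [DecidableEq V] (G : SimpleGraph V) (C C' : V → ℕ) : Prop :=
  ∃ u v, G.Adj u v ∧ 2 ≤ C u ∧
    C' = Function.update (Function.update C u (C u - 2)) v (C v + 1)

/-- Configuration `C` is `k`-fold `r`-solvable on `G`: some sequence of pebbling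
moves results in at least `k` pebbles on `r`. -/
def PebbSolvable {V : Type*} [DecidableEq V] (G : SimpleGraph V) (C : V → ℕ) (r : V)
    (k : ℕ) : Prop :=
  ∃ C', Relation.ReflTransGen (PebblingStep G) C C' ∧ k ≤ C' r

/-- The `k`-fold pebbling number of `G`: the least `n` such that for every root `r`,
every configuration of size at least `n` is `k`-fold `r`-solvable. -/
noncomputable def kPebblingNumber {V : Type*} [Fintype V] [DecidableEq V]
    (G : SimpleGraph V) (k : ℕ) : ℕ :=
  sInf {n | ∀ (r : V) (C : V → ℕ), n ≤ ∑ v, C v → PebbSolvable G C r k}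

/-- The pebbling number of `G`. -/
noncomputable def pebblingNumber {V : Type*} [Fintype V] [DecidableEq V]
    (G : SimpleGraph V) : ℕ :=
  kPebblingNumber G 1

open Relation

section Pebbling

variable {V W : Type*} [DecidableEq V] [DecidableEq W] {G : SimpleGraph V} {H : SimpleGraph W}

lemma pebblingStep_iff {C C' : V → ℕ} :
    PebblingStep G C C' ↔
      ∃ (u v : V) (D : V → ℕ), G.Adj u v ∧ C = D + Pi.single u 2 ∧ C' = D + Pi.single v 1 := by
  constructor
  · rintro ⟨u, v, huv, hu, rfl⟩
    refine ⟨u, v, Function.update C u (C u - 2), huv, ?_, ?_⟩ <;> ext w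
    · by_cases hw : w = u
      · subst hw; simp; omega
      · simp [hw]
    · by_cases hw : w = v
      · subst hw; simp [huv.ne']
      · simp [hw]
  · rintro ⟨u, v, D, huv, rfl, rfl⟩
    refine ⟨u, v, huv, by simp, ?_⟩
    ext w
    by_cases hw : w = v
    · subst hw; simp [huv.ne']
    · by_cases hwu : w = u
      · subst hwu; simp [hw]
      · simp [hw, hwu]

namespace PebblingStep

lemma add_right {C C' : V → ℕ} (h : PebblingStep G C C') (D : V → ℕ) :
    PebblingStep G (C + D) (C' + D) := by
  rw [pebblingStep_iff] at *
  obtain ⟨u, v, E, huv, rfl, rfl⟩ := h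
  exact ⟨u, v, E + D, huv, add_right_comm _ _ _, add_right_comm _ _ _⟩

lemma reflTransGen_add {C C' D D' : V → ℕ} (hC : ReflTransGen (PebblingStep G) C C')
    (hD : ReflTransGen (PebblingStep G) D D') :
    ReflTransGen (PebblingStep G) (C + D) (C' + D') := by
  refine (hC.lift (· + D) fun _ _ h => h.add_right D).trans ?_
  simp only [add_comm C']
  exact hD.lift (· + C') fun _ _ h => h.add_right C'

lemma reflTransGen_sum {ι : Type*} (s : Finset ι) {C C' : ι → V → ℕ}
    (h : ∀ i, ReflTransGen (PebblingStep G) (C i) (C' i)) :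
    ReflTransGen (PebblingStep G) (∑ i ∈ s, C i) (∑ i ∈ s, C' i) := by
  classical
  induction s using Finset.induction_on with
  | empty => exact .refl
  | insert i s hi ih =>
    rw [Finset.sum_insert hi, Finset.sum_insert hi]
    exact reflTransGen_add (h i) ih

lemma reflTransGen_nsmul {C C' : V → ℕ} (n : ℕ) (h : ReflTransGen (PebblingStep G) C C') :
    ReflTransGen (PebblingStep G) (n • C) (n • C') := by
  simpa using reflTransGen_sum (Finset.range n) fun _ => h

lemma reflTransGen_single_of_walk {u v : V} (p : G.Walk u v) :
    ReflTransGen (PebblingStep G) (Pi.single u (2 ^ p.length)) (Pi.single v 1) := by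
  induction p with
  | nil => exact .refl
  | @cons u v w huv p ih =>
    have hstep : PebblingStep G (Pi.single u 2) (Pi.single v 1) :=
      pebblingStep_iff.2 ⟨u, v, 0, huv, by simp, by simp⟩
    have h := reflTransGen_nsmul (2 ^ p.length) (ReflTransGen.single hstep)
    simp only [← Pi.single_smul, smul_eq_mul, mul_one] at h
    rw [SimpleGraph.Walk.length_cons, pow_succ]
    exact h.trans ih

end PebblingStep

/-- The configuration on `W` obtained by moving every pebble along `f : V → W`. -/
def pebblePush [Fintype V] (f : V → W) (C : V → ℕ) : W → ℕ :=
  fun w => ∑ v, if f v = w then C v else 0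

lemma pebblePush_add {α : Type*} [Fintype α] (f : α → W) (C D : α → ℕ) :
    pebblePush f (C + D) = pebblePush f C + pebblePush f D := by
  ext w
  simp only [pebblePush, Pi.add_apply, ← Finset.sum_add_distrib]
  exact Finset.sum_congr rfl fun v _ => by split_ifs <;> simp

lemma pebblePush_single [Fintype V] (f : V → W) (v : V) (n : ℕ) :
    pebblePush f (Pi.single v n) = Pi.single (f v) n := by
  ext w
  rw [pebblePush, Finset.sum_eq_single v (fun x _ hx => by simp [hx]) (by simp)]
  simp [Pi.single_apply, eq_comm]

lemma pebblePush_apply_of_injective [Fintype V] {f : V → W} (hf : f.Injective) (C : V → ℕ)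
    (v : V) : pebblePush f C (f v) = C v := by
  simp [pebblePush, hf.eq_iff]

lemma pebblePush_le [Fintype V] {f : V → W} (hf : f.Injective) {C : V → ℕ} {D : W → ℕ}
    (h : ∀ v, C v ≤ D (f v)) : pebblePush f C ≤ D := by
  intro w
  by_cases hw : ∃ v, f v = w
  · obtain ⟨v, rfl⟩ := hw
    rw [pebblePush_apply_of_injective hf]
    exact h v
  · push Not at hw
    simp [pebblePush, hw]

lemma PebblingStep.reflTransGen_push [Fintype V] (f : G →g H) {C C' : V → ℕ}
    (h : ReflTransGen (PebblingStep G) C C') :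
    ReflTransGen (PebblingStep H) (pebblePush f C) (pebblePush f C') := by
  refine h.lift _ fun C C' hs => ?_
  change PebblingStep H _ _
  rw [pebblingStep_iff] at *
  obtain ⟨u, v, D, huv, rfl, rfl⟩ := hs
  exact ⟨f u, f v, pebblePush f D, f.map_adj huv, by rw [pebblePush_add, pebblePush_single],
    by rw [pebblePush_add, pebblePush_single]⟩

lemma PebbSolvable.add {C D : V → ℕ} {r : V} {k l : ℕ} (hC : PebbSolvable G C r k)
    (hD : PebbSolvable G D r l) : PebbSolvable G (C + D) r (k + l) := by
  obtain ⟨C', hC, hk⟩ := hC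
  obtain ⟨D', hD, hl⟩ := hD
  exact ⟨_, PebblingStep.reflTransGen_add hC hD, add_le_add hk hl⟩

lemma pebbSolvable_zero (C : V → ℕ) (r : V) : PebbSolvable G C r 0 :=
  ⟨C, .refl, Nat.zero_le _⟩

lemma PebbSolvable.mono {C D : V → ℕ} {r : V} {k : ℕ} (h : PebbSolvable G C r k)
    (hCD : C ≤ D) : PebbSolvable G D r k := by
  have := h.add (pebbSolvable_zero (D - C) r)
  rwa [add_tsub_cancel_of_le hCD] at this

lemma PebbSolvable.push [Fintype V] (f : G →g H) (hf : Function.Injective f) {C : V → ℕ} {r : V}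
    {k : ℕ} (h : PebbSolvable G C r k) : PebbSolvable H (pebblePush f C) (f r) k := by
  obtain ⟨C', hC, hk⟩ := h
  exact ⟨_, PebblingStep.reflTransGen_push f hC,
    by rwa [pebblePush_apply_of_injective hf]⟩

lemma exists_le_sum_eq_of_le_sum [Fintype V] (C : V → ℕ) {n : ℕ} (hn : n ≤ ∑ v, C v) :
    ∃ D ≤ C, ∑ v, D v = n := by
  induction n with
  | zero => exact ⟨0, fun _ => Nat.zero_le _, by simp⟩
  | succ n ih =>
    obtain ⟨D, hD, rfl⟩ := ih (by omega)
    obtain ⟨v, -, hv⟩ := Finset.exists_lt_of_sum_lt (Nat.lt_of_succ_le hn)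
    refine ⟨D + Pi.single v 1, fun w => ?_, by simp [Finset.sum_add_distrib]⟩
    by_cases hw : w = v
    · subst hw; simpa using hv
    · simpa [hw] using hD w

lemma pebbSolvable_of_pebblingNumber_le [Fintype V] (hG : G.Connected) {r : V} {C : V → ℕ}
    (hC : pebblingNumber G ≤ ∑ v, C v) : PebbSolvable G C r 1 := by
  have hne : {n | ∀ (r : V) (C : V → ℕ), n ≤ ∑ v, C v → PebbSolvable G C r 1}.Nonempty := by
    let p (u v : V) : G.Walk u v := (hG.preconnected u v).some
    let N := ∑ x : V × V, 2 ^ (p x.1 x.2).length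
    have := hG.nonempty
    refine ⟨Fintype.card V * N, fun r C h => ?_⟩
    obtain ⟨v, -, hv⟩ : ∃ v ∈ Finset.univ, N ≤ C v :=
      Finset.exists_le_of_sum_le Finset.univ_nonempty (by simpa using h)
    have hN : 2 ^ (p v r).length ≤ N :=
      Finset.single_le_sum (f := fun x : V × V => 2 ^ (p x.1 x.2).length)
        (fun _ _ => Nat.zero_le _) (Finset.mem_univ (v, r))
    have hs : PebbSolvable G (Pi.single v (2 ^ (p v r).length)) r 1 :=
      ⟨_, PebblingStep.reflTransGen_single_of_walk _, by simp⟩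
    refine hs.mono fun w => ?_
    by_cases hw : w = v
    · subst hw; simpa using hN.trans hv
    · simp [hw]
  exact Nat.sInf_mem hne r C hC

lemma pebbSolvable_of_mul_pebblingNumber_le [Fintype V] (hG : G.Connected) {r : V} {k : ℕ}
    {C : V → ℕ} (hC : k * pebblingNumber G ≤ ∑ v, C v) : PebbSolvable G C r k := by
  induction k generalizing C with
  | zero => exact pebbSolvable_zero C r
  | succ k ih =>
    obtain ⟨D, hD, hsum⟩ := exists_le_sum_eq_of_le_sum C hC
    obtain ⟨E, hE, hEsum⟩ := exists_le_sum_eq_of_le_sum D (n := k * pebblingNumber G)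
      (by rw [hsum]; exact Nat.mul_le_mul_right _ k.le_succ)
    have hrest : pebblingNumber G ≤ ∑ v, (D - E) v := by
      have h : ∑ v, (E + (D - E)) v = ∑ v, D v := by rw [add_tsub_cancel_of_le hE]
      simp only [Pi.add_apply, Finset.sum_add_distrib] at h
      rw [hEsum, hsum, add_one_mul] at h
      omega
    have := (ih hEsum.ge).add (pebbSolvable_of_pebblingNumber_le hG (r := r) hrest)
    rw [add_tsub_cancel_of_le hE] at this
    exact this.mono hD

lemma card_le_pebblingNumber [Fintype V] (hG : G.Connected) :
    Fintype.card V ≤ pebblingNumber G := by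
  by_contra! hlt
  obtain ⟨r⟩ := hG.nonempty
  let C : V → ℕ := fun v => if v = r then 0 else 1
  have hsum : ∑ v, C v = Fintype.card V - 1 := by
    simp [C, Finset.sum_ite, Finset.filter_ne', Finset.card_univ]
  obtain ⟨C', hC, hr⟩ := pebbSolvable_of_pebblingNumber_le hG (r := r) (C := C) (by omega)
  rcases hC.cases_head with rfl | ⟨D, ⟨u, v, -, hu, -⟩, -⟩
  · simp [C] at hr
  · have : C u ≤ 1 := by simp only [C]; split_ifs <;> simp
    omega

lemma pebbSolvable_boxProd [Fintype V] [Fintype W] (hG : G.Connected) (hH : H.Connected)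
    {r : V × W} {C : V × W → ℕ}
    (hC : (pebblingNumber G + Fintype.card V) * pebblingNumber H ≤ ∑ x, C x) :
    PebbSolvable (G.boxProd H) C r 1 := by
  have hpos : 0 < pebblingNumber H := by
    have := hH.nonempty
    exact Fintype.card_pos.trans_le (card_le_pebblingNumber hH)
  let k : V → ℕ := fun g => (∑ h, C (g, h)) / pebblingNumber H
  have hk : pebblingNumber G ≤ ∑ g, k g := by
    have h1 : ∑ x, C x ≤ ∑ g, (k g + 1) * pebblingNumber H := by
      rw [Fintype.sum_prod_type]
      exact Finset.sum_le_sum fun g _ => (Nat.div_lt_iff_lt_mul hpos).1 (Nat.lt_succ_self _) |>.le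
    rw [← Finset.sum_mul, Finset.sum_add_distrib] at h1
    have h2 := Nat.le_of_mul_le_mul_right (hC.trans h1) hpos
    simpa using h2
  have hfiber (g : V) : PebbSolvable H (fun h => C (g, h)) r.2 (k g) :=
    pebbSolvable_of_mul_pebblingNumber_le hH (Nat.div_mul_le_self _ _)
  choose C' hreach hroot using hfiber
  have hdecomp : C = ∑ g, pebblePush (G.boxProdRight H g) (fun h => C (g, h)) := by
    ext ⟨g, h⟩
    simp only [pebblePush, Finset.sum_apply, SimpleGraph.boxProdRight_apply, Prod.mk.injEq, ite_and]
    simp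
  have hall : ReflTransGen (PebblingStep (G.boxProd H)) C
      (∑ g, pebblePush (G.boxProdRight H g) (C' g)) := by
    conv_lhs => rw [hdecomp]
    exact PebblingStep.reflTransGen_sum _ fun g =>
      PebblingStep.reflTransGen_push (G.boxProdRight H g).toHom (hreach g)
  have hinj : Function.Injective (G.boxProdLeft H r.2).toHom := (G.boxProdLeft H r.2).injective
  have hsolv := (pebbSolvable_of_pebblingNumber_le hG (r := r.1) hk).push
    (G.boxProdLeft H r.2).toHom hinj
  obtain ⟨E, hE, hE1⟩ := hsolv.mono (D := ∑ g, pebblePush (G.boxProdRight H g) (C' g))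
    (pebblePush_le hinj fun g => by
      rw [Finset.sum_apply]
      refine (hroot g).trans (le_trans ?_ (Finset.single_le_sum
        (fun _ _ => Nat.zero_le _) (Finset.mem_univ g)))
      exact (pebblePush_apply_of_injective (G.boxProdRight H g).injective (C' g) r.2).ge)
  exact ⟨E, hall.trans hE, hE1⟩

end Pebbling

/-- For connected graphs `G`, `H`: `π(G □ H) ≤ 2 · π(G) · π(H)`. -/
theorem pebblingNumber_boxProd_le_two_mul {V W : Type*} [Fintype V] [DecidableEq V]
    [Fintype W] [DecidableEq W] (G : SimpleGraph V) (H : SimpleGraph W)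
    (hG : G.Connected) (hH : H.Connected) :
    pebblingNumber (G.boxProd H) ≤ 2 * pebblingNumber G * pebblingNumber H := by
  refine Nat.sInf_le fun r C hC => pebbSolvable_boxProd hG hH (le_trans ?_ hC)
  gcongr
  have := card_le_pebblingNumber hG
  omega
end

section
/- Let G be a finite connected simple graph and H any finite simple graph. Then π(G ⋈ H) ≤ |G|·|H| + 4·π(G). -/
/-- The corona `G ⋈ H`: one copy of `G` and `|G|` disjoint copies of `H`, where the
vertex `g` of `G` is joined to every vertex of its own copy `{g} × V(H)` of `H`. -/
def corona {V W : Type*} (G : SimpleGraph V) (H : SimpleGraph W) :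
    SimpleGraph (V ⊕ V × W) :=
  SimpleGraph.fromRel (fun x y =>
    match x, y with
    | Sum.inl g, Sum.inl g' => G.Adj g g'
    | Sum.inl g, Sum.inr (g', _) => g = g'
    | Sum.inr (g, h), Sum.inr (g', h') => g = g' ∧ H.Adj h h'
    | _, _ => False)

section Pebbling

open Relation

variable {V : Type*} [DecidableEq V] {G : SimpleGraph V}

theorem PebblingStep.add_right_s16 {C C' : V → ℕ} (h : PebblingStep G C C') (D : V → ℕ) :
    PebblingStep G (C + D) (C' + D) := by
  obtain ⟨u, v, huv, hu, rfl⟩ := h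
  refine ⟨u, v, huv, by simp only [Pi.add_apply]; omega, ?_⟩
  have hne := huv.ne
  funext x
  simp only [Pi.add_apply, Function.update_apply]
  split_ifs <;> subst_vars <;> omega

theorem pebblingReach_add {C C' D D' : V → ℕ} (hC : ReflTransGen (PebblingStep G) C C')
    (hD : ReflTransGen (PebblingStep G) D D') :
    ReflTransGen (PebblingStep G) (C + D) (C' + D') := by
  refine (hC.lift (· + D) fun _ _ h => h.add_right_s16 D).trans ?_
  refine hD.lift (C' + ·) fun a b h => ?_
  change PebblingStep G (C' + a) (C' + b)
  rw [add_comm C' a, add_comm C' b]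
  exact h.add_right_s16 C'

theorem pebblingReach_sum {ι : Type*} (s : Finset ι) {C C' : ι → V → ℕ}
    (h : ∀ i ∈ s, ReflTransGen (PebblingStep G) (C i) (C' i)) :
    ReflTransGen (PebblingStep G) (∑ i ∈ s, C i) (∑ i ∈ s, C' i) := by
  classical
  induction s using Finset.induction_on with
  | empty => exact .refl
  | insert a s ha ih =>
    rw [Finset.sum_insert ha, Finset.sum_insert ha]
    exact pebblingReach_add (h a (by simp)) (ih fun i hi => h i (by simp [hi]))

theorem pebblingReach_single {u v : V} (huv : G.Adj u v) (m : ℕ) :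
    ReflTransGen (PebblingStep G) (Pi.single u (2 * m)) (Pi.single v m) := by
  induction m with
  | zero => simpa using ReflTransGen.refl
  | succ m ih =>
    rw [Nat.mul_succ, Pi.single_add, Pi.single_add]
    refine pebblingReach_add ih (.single ⟨u, v, huv, by simp, ?_⟩)
    have hne := huv.ne
    funext x
    simp only [Function.update_apply, Pi.single_apply]
    split_ifs <;> subst_vars <;> simp_all

theorem pebblingReach_single_of_walk {u v : V} (p : G.Walk u v) (m : ℕ) :
    ReflTransGen (PebblingStep G) (Pi.single u (2 ^ p.length * m)) (Pi.single v m) := by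
  induction p with
  | nil => simpa using ReflTransGen.refl
  | cons h p ih =>
    refine ReflTransGen.trans ?_ ih
    rw [SimpleGraph.Walk.length_cons, pow_succ', mul_assoc]
    exact pebblingReach_single h _

namespace PebbSolvable

theorem add_s16 {C D : V → ℕ} {r : V} {k l : ℕ} (hC : PebbSolvable G C r k)
    (hD : PebbSolvable G D r l) : PebbSolvable G (C + D) r (k + l) := by
  obtain ⟨C', hC, hk⟩ := hC
  obtain ⟨D', hD, hl⟩ := hD
  exact ⟨_, pebblingReach_add hC hD, add_le_add hk hl⟩

theorem mono_s16 {C D : V → ℕ} {r : V} {k l : ℕ} (hCD : C ≤ D) (hlk : l ≤ k)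
    (hC : PebbSolvable G C r k) : PebbSolvable G D r l := by
  obtain ⟨C', hC, hk⟩ := hC
  refine ⟨C' + (D - C), ?_, hlk.trans (hk.trans (Nat.le_add_right _ _))⟩
  have := pebblingReach_add hC (.refl (a := D - C))
  rwa [add_tsub_cancel_of_le hCD] at this

theorem of_reach {C D : V → ℕ} {r : V} {k : ℕ} (hCD : ReflTransGen (PebblingStep G) C D)
    (hD : PebbSolvable G D r k) : PebbSolvable G C r k := by
  obtain ⟨D', hD, hk⟩ := hD
  exact ⟨D', hCD.trans hD, hk⟩

theorem of_walk {C : V → ℕ} {u v : V} (p : G.Walk u v) {k : ℕ}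
    (h : 2 ^ p.length * k ≤ C u) : PebbSolvable G C v k := by
  refine mono_s16 (C := Pi.single u (2 ^ p.length * k)) ?_ le_rfl
    ⟨_, pebblingReach_single_of_walk p k, by simp⟩
  intro x
  by_cases hx : x = u
  · subst hx; simpa using h
  · simp [hx]

theorem of_adj {C : V → ℕ} {u v : V} (huv : G.Adj u v) {k : ℕ}
    (h : PebbSolvable G C u (2 * k)) : PebbSolvable G C v k := by
  obtain ⟨C', hC, hk⟩ := h
  exact of_reach hC (of_walk huv.toWalk (by simpa using hk))

theorem embed {V' : Type*} [DecidableEq V'] {G' : SimpleGraph V'} (f : V ↪ V')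
    (hf : ∀ u v, G.Adj u v → G'.Adj (f u) (f v)) {C : V' → ℕ} {r : V} {k : ℕ}
    (h : PebbSolvable G (C ∘ f) r k) : PebbSolvable G' C (f r) k := by
  obtain ⟨D', hD, hk⟩ := h
  suffices ∀ {D}, ReflTransGen (PebblingStep G) D D' → ∀ C : V' → ℕ, C ∘ f = D →
      PebbSolvable G' C (f r) k from this hD C rfl
  intro D hD
  induction hD using ReflTransGen.head_induction_on with
  | refl =>
    rintro C rfl
    exact ⟨C, .refl, hk⟩
  | head hstep _ ih =>
    rintro C rfl
    obtain ⟨u, v, huv, hu, rfl⟩ := hstep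
    refine of_reach (.single ⟨f u, f v, hf u v huv, hu, rfl⟩) (ih _ ?_)
    funext x
    simp [Function.update_apply]

end PebbSolvable

theorem exists_le_sum_eq [Fintype V] (C : V → ℕ) {n : ℕ} (hn : n ≤ ∑ v, C v) :
    ∃ A ≤ C, ∑ v, A v = n := by
  induction n with
  | zero => exact ⟨0, fun _ => Nat.zero_le _, by simp⟩
  | succ n ih =>
    obtain ⟨A, hA, hsum⟩ := ih (by omega)
    obtain ⟨v, -, hv⟩ := Finset.exists_lt_of_sum_lt (s := Finset.univ) (f := A) (g := C)
      (by omega)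
    refine ⟨A + Pi.single v 1, fun x => ?_, by simp [Finset.sum_add_distrib, hsum]⟩
    by_cases hx : x = v
    · subst hx; simpa using hv
    · simpa [hx] using hA x

theorem pebbSolvable_of_kPebblingNumber_le [Fintype V] (hG : G.Connected) {k : ℕ} (r : V)
    (C : V → ℕ) (hC : kPebblingNumber G k ≤ ∑ v, C v) : PebbSolvable G C r k := by
  refine Nat.sInf_mem (s := {n | ∀ (r : V) (C : V → ℕ), n ≤ ∑ v, C v → PebbSolvable G C r k})
    ⟨Fintype.card V * (2 ^ Fintype.card V * k), fun r C hC => ?_⟩ r C hC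
  have := hG.nonempty
  obtain ⟨u, -, hu⟩ := Finset.exists_le_of_sum_le (s := Finset.univ)
    (f := fun _ : V => 2 ^ Fintype.card V * k) (g := C) Finset.univ_nonempty (by simpa using hC)
  obtain ⟨p, hp⟩ := hG.preconnected.exists_isPath u r
  refine .of_walk p (le_trans ?_ hu)
  gcongr
  · norm_num
  · exact hp.length_lt.le

theorem pebbSolvable_two_of_two_mul_pebblingNumber_le [Fintype V] (hG : G.Connected) (r : V)
    (C : V → ℕ) (hC : 2 * pebblingNumber G ≤ ∑ v, C v) : PebbSolvable G C r 2 := by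
  obtain ⟨A, hA, hsum⟩ := exists_le_sum_eq C (n := pebblingNumber G) (by omega)
  have hAC : A + (C - A) = C := add_tsub_cancel_of_le hA
  have hsplit : ∑ v, A v + ∑ v, (C - A) v = ∑ v, C v := by
    rw [← Finset.sum_add_distrib]
    exact Finset.sum_congr rfl fun v _ => congrFun hAC v
  rw [← hAC]
  exact (pebbSolvable_of_kPebblingNumber_le hG r A hsum.ge).add_s16
    (pebbSolvable_of_kPebblingNumber_le hG r (C - A)
      (show pebblingNumber G ≤ _ by omega))

end Pebbling

section Corona

open Relation

variable {V W : Type*} (G : SimpleGraph V) (H : SimpleGraph W)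

theorem corona_adj_inl {u v : V} (h : G.Adj u v) : (corona G H).Adj (.inl u) (.inl v) := by
  simp [corona, h, h.ne]

theorem corona_adj_inl_inr (g : V) (h : W) :
    (corona G H).Adj (.inl g) (.inr (g, h)) := by
  simp [corona]

variable [Fintype V] [DecidableEq V] [Fintype W] [DecidableEq W]

/-- Moving as many pebbles as possible from the copies of `H` to the vertices of `G`. -/
theorem corona_exists_reach (C : V ⊕ V × W → ℕ) :
    ∃ C', ReflTransGen (PebblingStep (corona G H)) C C' ∧
      ∀ g, C' (.inl g) = C (.inl g) + ∑ h, C (.inr (g, h)) / 2 := by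
  let D : V ⊕ V × W → ℕ := Sum.elim (C ∘ .inl) fun x => C (.inr x) % 2
  have hC : D + ∑ x : V × W, Pi.single (.inr x) (2 * (C (.inr x) / 2)) = C := by
    funext y
    rcases y with g | y
    · simp [D, Finset.sum_apply]
    · simp only [Pi.add_apply, Finset.sum_apply, Pi.single_apply, Sum.inr.injEq, D,
        Sum.elim_inr, Finset.sum_ite_eq, Finset.mem_univ, if_true]
      omega
  refine ⟨D + ∑ x : V × W, Pi.single (.inl x.1) (C (.inr x) / 2), ?_, fun g => ?_⟩
  · conv_lhs => rw [← hC]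
    exact pebblingReach_add .refl (pebblingReach_sum _ fun x _ =>
      pebblingReach_single (corona_adj_inl_inr G H x.1 x.2).symm _)
  · simp [D, Finset.sum_apply, Pi.single_apply, Fintype.sum_prod_type_right]

end Corona

/-- For a connected graph `G` and any graph `H`: `π(G ⋈ H) ≤ |G||H| + 4π(G)`. -/
theorem pebblingNumber_corona_le {V W : Type*} [Fintype V] [DecidableEq V]
    [Fintype W] [DecidableEq W] (G : SimpleGraph V) (H : SimpleGraph W)
    (hG : G.Connected) :
    pebblingNumber (corona G H) ≤
      Fintype.card V * Fintype.card W + 4 * pebblingNumber G := by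
  refine Nat.sInf_le fun r C hC => ?_
  obtain ⟨C', hreach, hC'⟩ := corona_exists_reach G H C
  have hsize : 2 * pebblingNumber G ≤ ∑ g, C' (.inl g) := by
    have hleaf : ∑ x : V × W, C (.inr x) ≤
        2 * (∑ x : V × W, C (.inr x) / 2) + Fintype.card V * Fintype.card W := by
      rw [← Fintype.card_prod, ← Finset.card_univ, Finset.card_eq_sum_ones, Finset.mul_sum,
        ← Finset.sum_add_distrib]
      exact Finset.sum_le_sum fun x _ => by omega
    have htotal : ∑ g, C' (.inl g) = ∑ g, C (.inl g) + ∑ x : V × W, C (.inr x) / 2 := by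
      simp only [hC', Finset.sum_add_distrib, Fintype.sum_prod_type]
    rw [Fintype.sum_sum_type] at hC
    omega
  have htwo (g : V) : PebbSolvable (corona G H) C (.inl g) 2 :=
    .of_reach hreach <| .embed Function.Embedding.inl (fun _ _ h => corona_adj_inl G H h)
      (pebbSolvable_two_of_two_mul_pebblingNumber_le hG g _ hsize)
  rcases r with g | ⟨g, h⟩
  · exact (htwo g).mono_s16 le_rfl one_le_two
  · exact .of_adj (corona_adj_inl_inr G H g h) (htwo g)
end
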